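/- The n-th Ramanujan prime is asymptotic to the 2n-th prime: the ratio R_n / p_{2n} tends to 1 as n → ∞. -/

import Mathlib

/-- The `n`-th Ramanujan prime: the smallest positive integer `R` such that for every
integer `x ≥ R` we have `π(x) − π(x/2) ≥ n`, where `π` counts primes and `x/2`
is `⌊x/2⌋`. -/
noncomputable def ramanujan (n : ℕ) : ℕ :=
  sInf {R : ℕ | 0 < R ∧ ∀ x : ℕ, R ≤ x → n ≤ x.primeCounting - (x / 2).primeCounting}
/-- `nthPrime k` is the `k`-th prime, 1-indexed: `nthPrime 1 = 2`, `nthPrime 2 = 3`, ... -/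
noncomputable def nthPrime (k : ℕ) : ℕ := Nat.nth Nat.Prime (k - 1)

open Filter Topology MeasureTheory Set

/-- Half of the Fejér kernel: the cosine transform of the tent function on `[0, 1]`. -/
noncomputable def fejerKernel (u : ℝ) : ℝ := ∫ y in (0 : ℝ)..1, (1 - y) * Real.cos (u * y)

theorem fejerKernel_eq {u : ℝ} (hu : u ≠ 0) : fejerKernel u = (1 - Real.cos u) / u ^ 2 := by
  have hderiv : ∀ y ∈ uIcc (0 : ℝ) 1,
      HasDerivAt (fun y ↦ (1 - y) * Real.sin (u * y) / u - Real.cos (u * y) / u ^ 2)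
        ((1 - y) * Real.cos (u * y)) y := by
    intro y _
    have hlin : HasDerivAt (fun y : ℝ ↦ u * y) u y := by
      simpa using (hasDerivAt_id y).const_mul u
    have hsub : HasDerivAt (fun y : ℝ ↦ 1 - y) (-1) y := by
      simpa using (hasDerivAt_id y).const_sub 1
    have h := ((hsub.mul hlin.sin).div_const u).sub (hlin.cos.div_const (u ^ 2))
    refine h.congr_deriv ?_
    field_simp
    ring
  rw [fejerKernel, intervalIntegral.integral_eq_sub_of_hasDerivAt hderiv
    (Continuous.intervalIntegrable (by fun_prop) _ _)]
  simp
  ring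

theorem continuous_fejerKernel : Continuous fejerKernel := by
  unfold fejerKernel
  fun_prop

theorem fejerKernel_zero : fejerKernel 0 = 1 / 2 := by
  simp only [fejerKernel, zero_mul, Real.cos_zero, mul_one]
  rw [intervalIntegral.integral_sub (by simp) (by simp)]
  norm_num

theorem fejerKernel_nonneg (u : ℝ) : 0 ≤ fejerKernel u := by
  rcases eq_or_ne u 0 with rfl | hu
  · norm_num [fejerKernel_zero]
  · rw [fejerKernel_eq hu]
    exact div_nonneg (sub_nonneg.mpr (Real.cos_le_one u)) (sq_nonneg u)

theorem fejerKernel_le (u : ℝ) : fejerKernel u ≤ 4 * (1 + u ^ 2)⁻¹ := by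
  rw [← div_eq_mul_inv, le_div_iff₀ (by positivity)]
  rcases eq_or_ne u 0 with rfl | hu
  · norm_num [fejerKernel_zero]
  have hu2 : 0 < u ^ 2 := by positivity
  rw [fejerKernel_eq hu, div_mul_eq_mul_div, div_le_iff₀ hu2]
  nlinarith [Real.one_sub_sq_div_two_le_cos (x := u), Real.neg_one_le_cos u, Real.cos_le_one u]

theorem integrable_fejerKernel : Integrable fejerKernel :=
  (integrable_inv_one_add_sq.const_mul 4).mono' continuous_fejerKernel.aestronglyMeasurable
    (.of_forall fun u ↦ by
      rw [Real.norm_of_nonneg (fejerKernel_nonneg u)]; exact fejerKernel_le u)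

theorem integral_fejerKernel_pos : 0 < ∫ u, fejerKernel u :=
  integral_pos_of_integrable_nonneg_nonzero continuous_fejerKernel integrable_fejerKernel
    fejerKernel_nonneg (x := 0) (by norm_num [fejerKernel_zero])

theorem eventually_not_forall_Icc_le_of_tendsto_integral_mul_fejerKernel {b : ℝ → ℝ} {M : ℝ}
    (hb : Measurable b) (hM : ∀ t, |b t| ≤ M)
    (hlim : ∀ l : ℝ, 0 < l → Tendsto (fun T ↦ ∫ t, b t * fejerKernel (l * (T - t))) atTop (𝓝 0))
    {ε h : ℝ} (hε : 0 < ε) (hh : 0 < h) :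
    ∀ᶠ T in atTop, ¬ ∀ t ∈ Icc (T - h) (T + h), ε ≤ b t := by
  set c := ∫ u, fejerKernel u
  have hc : 0 < c := integral_fejerKernel_pos
  have hM0 : 0 ≤ M := (abs_nonneg _).trans (hM 0)
  have htail : Tendsto (fun A : ℝ ↦ (ε + M) * (∫ u in -A..A, fejerKernel u) - M * c) atTop
      (𝓝 ((ε + M) * c - M * c)) :=
    ((intervalIntegral_tendsto_integral integrable_fejerKernel tendsto_neg_atTop_atBot
      tendsto_id).const_mul _).sub_const _
  have hpos : 0 < (ε + M) * c - M * c := by nlinarith [mul_pos hε hc]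
  obtain ⟨A, hA, hA0⟩ := ((htail.eventually (lt_mem_nhds hpos)).and (eventually_gt_atTop 0)).exists
  set g : ℝ → ℝ := fun u ↦
    (ε + M) * (Ioc (-A) A).indicator fejerKernel u - M * fejerKernel u with hg
  have hgi1 : Integrable ((Ioc (-A) A).indicator fejerKernel) :=
    integrable_fejerKernel.indicator measurableSet_Ioc
  have hgi : Integrable g := (hgi1.const_mul _).sub (integrable_fejerKernel.const_mul _)
  have hgint : 0 < ∫ u, g u := by
    rw [integral_sub (hgi1.const_mul _) (integrable_fejerKernel.const_mul _), integral_const_mul,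
      integral_const_mul, integral_indicator measurableSet_Ioc,
      ← intervalIntegral.integral_of_le (by linarith)]
    exact hA
  set l := A / h
  have hl : 0 < l := by positivity
  have hlh : l * h = A := div_mul_cancel₀ _ hh.ne'
  have hη : 0 < l⁻¹ * ∫ u, g u := by positivity
  filter_upwards [(hlim l hl).eventually (gt_mem_nhds hη)] with T hT hcon
  refine hT.not_ge ?_
  have hchange : ∫ t, g (l * (T - t)) = l⁻¹ * ∫ u, g u := by
    rw [integral_sub_left_eq_self (fun t ↦ g (l * t)) volume T, Measure.integral_comp_mul_left,
      abs_of_pos (inv_pos.mpr hl), smul_eq_mul]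
  have hscale {f : ℝ → ℝ} (hf : Integrable f) : Integrable fun t ↦ f (l * (T - t)) :=
    (hf.comp_mul_left' hl.ne').comp_sub_left T
  rw [← hchange]
  refine integral_mono (hscale hgi) ((hscale integrable_fejerKernel).bdd_mul
    hb.aestronglyMeasurable (.of_forall hM)) fun t ↦ ?_
  have hK := fejerKernel_nonneg (l * (T - t))
  have hbt := neg_le_of_abs_le (hM t)
  simp only [hg, indicator_apply]
  split_ifs with hmem
  · have ht : t ∈ Icc (T - h) (T + h) := by
      rw [← hlh] at hmem
      have h1 : l * (-h) < l * (T - t) := by linarith [hmem.1]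
      have h2 := le_of_mul_le_mul_left hmem.2 hl
      have h3 := lt_of_mul_lt_mul_left h1 hl.le
      exact ⟨by linarith, by linarith⟩
    nlinarith [hcon t ht]
  · nlinarith

theorem integral_mul_exp_mul_fejerKernel {b : ℝ → ℝ} {F : ℂ → ℂ} {σ : ℝ}
    (hbi : Integrable fun t ↦ b t * Real.exp (-σ * t))
    (hF : ∀ s : ℂ, s.re = σ → ∫ t : ℝ, (b t : ℂ) * Complex.exp (-(s * t)) = F s) (l T : ℝ) :
    ∫ t, b t * Real.exp (-σ * t) * fejerKernel (l * (T - t)) =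
      ∫ y in (0 : ℝ)..1, (1 - y) *
        (Complex.exp (Complex.I * (l * y * T)) * F (σ + Complex.I * (l * y))).re := by
  have hint : Integrable (fun z : ℝ × ℝ ↦ Real.cos (l * (T - z.2) * z.1) *
      ((1 - z.1) * (b z.2 * Real.exp (-σ * z.2))))
      ((volume.restrict (uIoc 0 1)).prod volume) := by
    refine Integrable.bdd_mul (c := 1) (Integrable.mul_prod ?_ hbi)
      (Continuous.aestronglyMeasurable (by fun_prop)) (.of_forall fun z ↦ Real.abs_cos_le_one _)
    exact (intervalIntegrable_iff.mp (Continuous.intervalIntegrable (by fun_prop) 0 1))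
  have hswap := intervalIntegral_integral_swap (f := fun y t ↦ Real.cos (l * (T - t) * y) *
      ((1 - y) * (b t * Real.exp (-σ * t)))) hint
  calc
    _ = ∫ t, ∫ y in (0 : ℝ)..1, Real.cos (l * (T - t) * y) *
        ((1 - y) * (b t * Real.exp (-σ * t))) := by
      refine integral_congr_ae (.of_forall fun t ↦ ?_)
      simp only [fejerKernel, ← intervalIntegral.integral_const_mul]
      congr 1 with y
      ring
    _ = _ := hswap.symm
    _ = _ := by
      refine intervalIntegral.integral_congr fun y _ ↦ ?_
      have hexp (t : ℝ) : (b t : ℂ) * Complex.exp (-((σ + Complex.I * (l * y)) * t)) =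
          ((b t * Real.exp (-σ * t) : ℝ) : ℂ) * Complex.exp (-(Complex.I * (l * y * t))) := by
        rw [show -((σ + Complex.I * (l * y)) * t) = ((-σ * t : ℝ) : ℂ) +
          -(Complex.I * (l * y * t)) by push_cast; ring, Complex.exp_add]
        push_cast
        ring
      have hci : Integrable fun t : ℝ ↦ Complex.exp (Complex.I * (l * y * T)) *
          ((b t : ℂ) * Complex.exp (-((σ + Complex.I * (l * y)) * t))) := by
        simp_rw [hexp]
        refine Integrable.const_mul (Integrable.mul_bdd (c := 1) hbi.ofReal
          (Continuous.aestronglyMeasurable (by fun_prop)) (.of_forall fun t ↦ ?_)) _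
        rw [Complex.norm_exp]
        simp
      rw [← hF _ (by simp), ← integral_const_mul, ← Complex.reCLM_apply,
        ← Complex.reCLM.integral_comp_comm hci, ← integral_const_mul]
      refine integral_congr_ae (.of_forall fun t ↦ ?_)
      simp only [Complex.reCLM_apply]
      rw [hexp, mul_left_comm (Complex.exp _), ← Complex.exp_add, Complex.re_ofReal_mul,
        show Complex.I * (l * y * T) + -(Complex.I * (l * y * t)) =
          ((l * (T - t) * y : ℝ) : ℂ) * Complex.I by push_cast; ring,
        Complex.exp_ofReal_mul_I_re]
      ring

theorem integral_mul_fejerKernel {b : ℝ → ℝ} {M : ℝ} (hb : Measurable b) (hM : ∀ t, |b t| ≤ M)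
    (hb0 : ∀ t ≤ 0, b t = 0) {F : ℂ → ℂ} (hFc : ContinuousOn F {s | 0 ≤ s.re})
    (hF : ∀ s : ℂ, 0 < s.re → ∫ t : ℝ, (b t : ℂ) * Complex.exp (-(s * t)) = F s)
    {l : ℝ} (hl : 0 < l) (T : ℝ) :
    ∫ t, b t * fejerKernel (l * (T - t)) = ∫ y in (0 : ℝ)..1, (1 - y) *
      (Complex.exp (Complex.I * (l * y * T)) * F (Complex.I * (l * y))).re := by
  have hbi {σ : ℝ} (hσ : 0 < σ) : Integrable fun t ↦ b t * Real.exp (-σ * t) := by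
    have : IntegrableOn (fun t ↦ b t * Real.exp (-σ * t)) (Ioi 0) :=
      (exp_neg_integrableOn_Ioi 0 hσ).bdd_mul hb.aestronglyMeasurable.restrict (.of_forall hM)
    refine (integrableOn_iff_integrable_of_support_subset fun t ht ↦ ?_).mp this
    by_contra h
    exact ht (by simp [hb0 t (not_lt.mp h)])
  have hKi : Integrable fun t ↦ fejerKernel (l * (T - t)) :=
    (integrable_fejerKernel.comp_mul_left' hl.ne').comp_sub_left T
  have hleft : Tendsto (fun σ : ℝ ↦ ∫ t, b t * Real.exp (-σ * t) * fejerKernel (l * (T - t)))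
      (𝓝[>] 0) (𝓝 (∫ t, b t * fejerKernel (l * (T - t)))) := by
    refine tendsto_integral_filter_of_dominated_convergence
      (fun t ↦ M * fejerKernel (l * (T - t))) (.of_forall fun σ ↦ ?_) ?_ (hKi.const_mul M)
      (.of_forall fun t ↦ ?_)
    · exact (hb.mul (by fun_prop)).aestronglyMeasurable.mul hKi.aestronglyMeasurable
    · filter_upwards [self_mem_nhdsWithin] with σ hσ
      refine .of_forall fun t ↦ ?_
      rw [norm_mul, Real.norm_of_nonneg (fejerKernel_nonneg _)]
      refine mul_le_mul_of_nonneg_right ?_ (fejerKernel_nonneg _)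
      rcases le_or_gt t 0 with ht | ht
      · simpa [hb0 t ht] using (abs_nonneg _).trans (hM t)
      · rw [norm_mul, Real.norm_of_nonneg (Real.exp_nonneg _)]
        refine (mul_le_of_le_one_right (norm_nonneg _) (Real.exp_le_one_iff.mpr ?_)).trans (hM t)
        have : 0 < σ := hσ
        nlinarith
    · refine Tendsto.mono_left (Continuous.tendsto' (by fun_prop) _ _ (by simp)) nhdsWithin_le_nhds
  set f : ℝ × ℝ → ℝ := fun z ↦ (1 - z.2) *
    (Complex.exp (Complex.I * (l * z.2 * T)) * F (z.1 + Complex.I * (l * z.2))).re with hf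
  have hfc : ContinuousOn f (Ici 0 ×ˢ univ) := by
    refine ContinuousOn.mul (by fun_prop) (Complex.continuous_re.comp_continuousOn
      (ContinuousOn.mul (by fun_prop) (hFc.comp (by fun_prop) fun z hz ↦ ?_)))
    simpa using hz.1
  obtain ⟨C, hC⟩ := ((isCompact_Icc.prod isCompact_Icc).exists_bound_of_continuousOn
    (hfc.mono (prod_mono (Icc_subset_Ici_self : Icc (0 : ℝ) 1 ⊆ Ici 0)
      (subset_univ (Icc (0 : ℝ) 1)))))
  have hright : Tendsto (fun σ : ℝ ↦ ∫ y in (0 : ℝ)..1, f (σ, y)) (𝓝[>] 0)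
      (𝓝 (∫ y in (0 : ℝ)..1, f (0, y))) := by
    refine intervalIntegral.tendsto_integral_filter_of_dominated_convergence (fun _ ↦ C) ?_ ?_
      (by simp) (.of_forall fun y _ ↦ ?_)
    · filter_upwards [self_mem_nhdsWithin] with σ hσ
      refine Continuous.aestronglyMeasurable (continuousOn_univ.mp ?_)
      exact hfc.comp (by fun_prop) fun y _ ↦ ⟨Ioi_subset_Ici_self hσ, mem_univ _⟩
    · filter_upwards [Ioc_mem_nhdsGT zero_lt_one] with σ hσ
      refine .of_forall fun y hy ↦ hC _ ⟨⟨hσ.1.le, hσ.2⟩, ?_⟩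
      rw [uIoc_of_le zero_le_one] at hy
      exact ⟨hy.1.le, hy.2⟩
    · have : ContinuousWithinAt (fun σ : ℝ ↦ f (σ, y)) (Ici 0) 0 :=
        (hfc.comp (t := Ici 0 ×ˢ univ) (f := fun σ : ℝ ↦ (σ, y)) (by fun_prop)
          fun σ hσ ↦ ⟨hσ, mem_univ _⟩) 0 self_mem_Ici
      exact this.tendsto.mono_left (nhdsWithin_mono _ Ioi_subset_Ici_self)
  have huniq := tendsto_nhds_unique (hleft.congr' ?_) hright
  · simpa [hf] using huniq
  · filter_upwards [self_mem_nhdsWithin] with σ hσ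
    exact integral_mul_exp_mul_fejerKernel (hbi hσ)
      (fun s hs ↦ hF s (by rw [hs]; exact hσ)) l T

theorem tendsto_integral_mul_fejerKernel {b : ℝ → ℝ} {M : ℝ} (hb : Measurable b)
    (hM : ∀ t, |b t| ≤ M) (hb0 : ∀ t ≤ 0, b t = 0) {F : ℂ → ℂ}
    (hFc : ContinuousOn F {s | 0 ≤ s.re})
    (hF : ∀ s : ℂ, 0 < s.re → ∫ t : ℝ, (b t : ℂ) * Complex.exp (-(s * t)) = F s)
    {l : ℝ} (hl : 0 < l) :
    Tendsto (fun T ↦ ∫ t, b t * fejerKernel (l * (T - t))) atTop (𝓝 0) := by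
  set g : ℝ → ℂ := (Ioc 0 1).indicator fun y ↦ (1 - y) * F (Complex.I * (l * y)) with hg
  have hgi : Integrable g := by
    refine IntegrableOn.integrable_indicator ?_ measurableSet_Ioc
    refine (Continuous.integrableOn_Icc ?_).mono_set Ioc_subset_Icc_self
    refine Continuous.mul (by fun_prop) (continuousOn_univ.mp (hFc.comp (by fun_prop) ?_))
    intro y _
    simp
  have hw : Tendsto (fun T : ℝ ↦ -(l / (2 * Real.pi)) * T) atTop (cocompact ℝ) :=
    (tendsto_id.const_mul_atTop_of_neg
      (by rw [neg_lt_zero]; positivity)).mono_right atBot_le_cocompact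
  have hRL := (Complex.continuous_re.tendsto' 0 0 rfl).comp
    ((Real.tendsto_integral_exp_smul_cocompact g).comp hw)
  refine hRL.congr fun T ↦ ?_
  have hphase (y : ℝ) : (Real.fourierChar (-(y * (-(l / (2 * Real.pi)) * T))) : ℂ) =
      Complex.exp (Complex.I * (l * y * T)) := by
    rw [Real.fourierChar_apply]
    congr 1
    push_cast
    have : (Real.pi : ℂ) ≠ 0 := Complex.ofReal_ne_zero.mpr Real.pi_ne_zero
    field_simp
  have hint := (Real.fourierIntegral_convergent_iff (-(l / (2 * Real.pi)) * T)).mpr hgi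
  rw [integral_mul_fejerKernel hb hM hb0 hFc hF hl, intervalIntegral.integral_of_le zero_le_one,
    ← integral_indicator measurableSet_Ioc]
  simp only [Function.comp_apply]
  rw [← Complex.reCLM_apply, ← Complex.reCLM.integral_comp_comm (by simpa [mul_comm] using hint)]
  refine integral_congr_ae (.of_forall fun y ↦ ?_)
  simp only [hg, indicator_apply, Complex.reCLM_apply, Circle.smul_def, hphase, smul_eq_mul]
  split_ifs
  · rw [mul_left_comm, ← Complex.ofReal_one, ← Complex.ofReal_sub, Complex.re_ofReal_mul]
  · simp

/-- The difference `ψ (exp t) / exp t - 1`, cut off to positive `t`. -/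
noncomputable def psiExpError : ℝ → ℝ :=
  (Ioi 0).indicator fun t ↦ Chebyshev.psi (Real.exp t) * Real.exp (-t) - 1

theorem psiExpError_of_pos {t : ℝ} (ht : 0 < t) :
    psiExpError t = Chebyshev.psi (Real.exp t) * Real.exp (-t) - 1 :=
  indicator_of_mem (mem_Ioi.mpr ht) _

theorem measurable_psi_exp_mul_exp_neg :
    Measurable fun t ↦ Chebyshev.psi (Real.exp t) * Real.exp (-t) :=
  (Chebyshev.psi_mono.measurable.comp Real.measurable_exp).mul (by fun_prop)

theorem measurable_psiExpError : Measurable psiExpError :=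
  (measurable_psi_exp_mul_exp_neg.sub_const 1).indicator measurableSet_Ioi

theorem psi_exp_mul_exp_neg_nonneg (t : ℝ) :
    0 ≤ Chebyshev.psi (Real.exp t) * Real.exp (-t) :=
  mul_nonneg (Chebyshev.psi_nonneg _) (Real.exp_nonneg _)

theorem psi_exp_mul_exp_neg_le (t : ℝ) :
    Chebyshev.psi (Real.exp t) * Real.exp (-t) ≤ Real.log 4 + 4 := by
  have h := mul_le_mul_of_nonneg_right
    (Chebyshev.psi_le_const_mul_self (Real.exp_nonneg t)) (Real.exp_nonneg (-t))
  rwa [mul_assoc, ← Real.exp_add, add_neg_cancel, Real.exp_zero, mul_one] at h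

theorem abs_psiExpError_le (t : ℝ) : |psiExpError t| ≤ Real.log 4 + 4 := by
  have h4 : 0 ≤ Real.log 4 := Real.log_nonneg (by norm_num)
  rcases le_or_gt t 0 with ht | ht
  · rw [psiExpError, indicator_of_notMem (notMem_Ioi.mpr ht), abs_zero]
    positivity
  · rw [psiExpError_of_pos ht, abs_le]
    constructor <;> linarith [psi_exp_mul_exp_neg_nonneg t, psi_exp_mul_exp_neg_le t]

theorem LSeries_vonMangoldt_eq_integral_psi_exp {s : ℂ} (hs : 0 < s.re) :
    LSeries (fun n ↦ (ArithmeticFunction.vonMangoldt n : ℂ)) (1 + s) =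
      (1 + s) * ∫ t in Ioi (0 : ℝ),
        ((Chebyshev.psi (Real.exp t) * Real.exp (-t) : ℝ) : ℂ) * Complex.exp (-(s * t)) := by
  have hpsi (x : ℝ) : ∑ k ∈ Finset.Icc 1 ⌊x⌋₊, ArithmeticFunction.vonMangoldt k =
      Chebyshev.psi x := rfl
  have hO : (fun n : ℕ ↦ ∑ k ∈ Finset.Icc 1 n, ArithmeticFunction.vonMangoldt k) =O[atTop]
      fun n ↦ (n : ℝ) ^ (1 : ℝ) := by
    refine .of_bound (Real.log 4 + 4) (.of_forall fun n ↦ ?_)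
    have h := hpsi n
    rw [Nat.floor_natCast] at h
    rw [h, Real.norm_of_nonneg (Chebyshev.psi_nonneg _), Real.rpow_one,
      Real.norm_of_nonneg n.cast_nonneg]
    exact Chebyshev.psi_le_const_mul_self n.cast_nonneg
  rw [LSeries_eq_mul_integral_of_nonneg _ zero_le_one (by simpa using hs) hO
    fun _ ↦ ArithmeticFunction.vonMangoldt_nonneg]
  have himage : Real.exp '' Ioi 0 = Ioi 1 := by
    rw [Real.image_exp_Ioi, Real.exp_zero]
  rw [← himage, integral_image_eq_integral_abs_deriv_smul measurableSet_Ioi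
    (fun t _ ↦ (Real.hasDerivAt_exp t).hasDerivWithinAt) Real.exp_injective.injOn]
  congr 1
  refine integral_congr_ae (.of_forall fun t ↦ ?_)
  simp only
  rw [← Complex.ofReal_sum, hpsi, abs_of_pos (Real.exp_pos t), Complex.real_smul,
    Complex.cpow_def_of_ne_zero (by exact_mod_cast (Real.exp_pos t).ne'),
    ← Complex.ofReal_log (Real.exp_nonneg t), Real.log_exp, Complex.ofReal_mul,
    mul_left_comm, mul_assoc]
  congr 1
  push_cast
  rw [← Complex.exp_add, ← Complex.exp_add]
  congr 1
  ring

theorem integral_psiExpError_mul_exp {s : ℂ} (hs : 0 < s.re) :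
    ∫ t : ℝ, (psiExpError t : ℂ) * Complex.exp (-(s * t)) =
      (ArithmeticFunction.vonMangoldt.LFunctionResidueClassAux (1 : ZMod 1) (1 + s) - 1) /
        (1 + s) := by
  have hs0 : s ≠ 0 := by
    rintro rfl
    simp at hs
  have hs1 : 1 + s ≠ 0 := by
    intro h
    have := congrArg Complex.re h
    simp at this
    linarith
  have hexp : IntegrableOn (fun t : ℝ ↦ Complex.exp (-(s * t))) (Ioi 0) := by
    simpa only [neg_mul] using integrableOn_exp_mul_complex_Ioi (a := -s) (by simpa using hs) 0
  have hexpint : ∫ t : ℝ in Ioi 0, Complex.exp (-(s * t)) = 1 / s := by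
    have := integral_exp_mul_complex_Ioi (a := -s) (by simpa using hs) 0
    simpa [neg_mul] using this
  have hpsi : IntegrableOn (fun t : ℝ ↦
      ((Chebyshev.psi (Real.exp t) * Real.exp (-t) : ℝ) : ℂ) * Complex.exp (-(s * t))) (Ioi 0) := by
    refine hexp.bdd_mul (c := Real.log 4 + 4) (Complex.measurable_ofReal.comp
      measurable_psi_exp_mul_exp_neg).aestronglyMeasurable (.of_forall fun t ↦ ?_)
    rw [Complex.norm_real, Real.norm_of_nonneg (psi_exp_mul_exp_neg_nonneg t)]
    exact psi_exp_mul_exp_neg_le t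
  have hL := ArithmeticFunction.vonMangoldt.eqOn_LFunctionResidueClassAux
    (a := (1 : ZMod 1)) isUnit_one (x := 1 + s) (by simpa using hs)
  have hclass : ArithmeticFunction.vonMangoldt.residueClass (1 : ZMod 1) =
      fun n ↦ ArithmeticFunction.vonMangoldt n := by
    ext n
    exact indicator_of_mem (s := {n : ℕ | (n : ZMod 1) = 1}) (Subsingleton.elim _ _) _
  calc
    _ = ∫ t in Ioi (0 : ℝ), (((Chebyshev.psi (Real.exp t) * Real.exp (-t) : ℝ) : ℂ) *
        Complex.exp (-(s * t)) - Complex.exp (-(s * t))) := by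
      rw [← integral_indicator measurableSet_Ioi]
      refine integral_congr_ae (.of_forall fun t ↦ ?_)
      simp only [psiExpError, indicator_apply]
      split_ifs
      · push_cast
        ring
      · simp
    _ = _ := by
      rw [integral_sub hpsi hexp, hexpint, hL]
      simp only [hclass, Nat.totient_one, Nat.cast_one, inv_one, add_sub_cancel_left]
      rw [LSeries_vonMangoldt_eq_integral_psi_exp hs]
      generalize ∫ t in Ioi (0 : ℝ), ((Chebyshev.psi (Real.exp t) * Real.exp (-t) : ℝ) : ℂ) *
        Complex.exp (-(s * t)) = J
      field_simp
      ring

theorem tendsto_integral_psiExpError_mul_fejerKernel {l : ℝ} (hl : 0 < l) :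
    Tendsto (fun T ↦ ∫ t, psiExpError t * fejerKernel (l * (T - t))) atTop (𝓝 0) := by
  refine tendsto_integral_mul_fejerKernel measurable_psiExpError abs_psiExpError_le
    (fun t ht ↦ indicator_of_notMem (notMem_Ioi.mpr ht) _) (F := fun s ↦
      (ArithmeticFunction.vonMangoldt.LFunctionResidueClassAux (1 : ZMod 1) (1 + s) - 1) /
        (1 + s)) ?_ (fun s hs ↦ integral_psiExpError_mul_exp hs) hl
  refine ContinuousOn.div (ContinuousOn.sub
    ((ArithmeticFunction.vonMangoldt.continuousOn_LFunctionResidueClassAux (1 : ZMod 1)).comp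
      (by fun_prop) fun s hs ↦ ?_) continuousOn_const) (by fun_prop) fun s hs h ↦ ?_
  · simpa using hs
  · have h0 : 0 ≤ s.re := hs
    have := congrArg Complex.re h
    simp at this
    linarith

theorem psi_exp_mul_exp_neg_le_mul {s t : ℝ} (hst : s ≤ t) :
    Chebyshev.psi (Real.exp s) * Real.exp (-s) ≤
      Chebyshev.psi (Real.exp t) * Real.exp (-t) * Real.exp (t - s) := by
  rw [mul_assoc, ← Real.exp_add, neg_add_eq_sub, sub_sub_cancel_left]
  exact mul_le_mul_of_nonneg_right (Chebyshev.psi_mono (Real.exp_le_exp.mpr hst))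
    (Real.exp_nonneg _)

theorem tendsto_psiExpError : Tendsto psiExpError atTop (𝓝 0) := by
  rw [Metric.tendsto_nhds]
  intro ε' hε'
  obtain ⟨ε, hε, hε1, hεε'⟩ : ∃ ε : ℝ, 0 < ε ∧ ε ≤ 1 ∧ ε ≤ ε' :=
    ⟨min 1 ε', by positivity, min_le_left _ _, min_le_right _ _⟩
  set h := Real.log (1 + ε / 4) / 2 with hh
  have hh0 : 0 < h := half_pos (Real.log_pos (by linarith))
  have hexp {u : ℝ} (hu : u ≤ 2 * h) : Real.exp u ≤ 1 + ε / 4 := by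
    rw [← Real.exp_log (show 0 < 1 + ε / 4 by linarith)]
    exact Real.exp_le_exp.mpr (by linarith)
  have hupper := eventually_not_forall_Icc_le_of_tendsto_integral_mul_fejerKernel
    measurable_psiExpError abs_psiExpError_le
    (fun l hl ↦ tendsto_integral_psiExpError_mul_fejerKernel hl) (half_pos hε) hh0
  have hlower := eventually_not_forall_Icc_le_of_tendsto_integral_mul_fejerKernel
    measurable_psiExpError.neg (fun t ↦ (abs_neg _).trans_le (abs_psiExpError_le t))
    (fun l hl ↦ by
      simpa only [Pi.neg_apply, neg_mul, integral_neg, neg_zero] using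
        (tendsto_integral_psiExpError_mul_fejerKernel hl).neg) (half_pos hε) hh0
  filter_upwards [(tendsto_atTop_add_const_right atTop h tendsto_id).eventually hupper,
    (tendsto_atTop_add_const_right atTop (-h) tendsto_id).eventually hlower,
    eventually_gt_atTop (2 * h)] with t hup hlow ht
  rw [Real.dist_0_eq_abs]
  refine lt_of_lt_of_le (abs_lt.mpr ⟨?_, ?_⟩) hεε'
  · by_contra! hcon
    refine hlow fun s hs ↦ ?_
    simp only [id, mem_Icc] at hs
    rw [psiExpError_of_pos (by linarith)] at hcon
    rw [Pi.neg_apply, psiExpError_of_pos (by linarith)]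
    have h1 := psi_exp_mul_exp_neg_le_mul (show s ≤ t by linarith)
    have h2 := mul_le_mul_of_nonneg_left (hexp (show t - s ≤ 2 * h by linarith))
      (psi_exp_mul_exp_neg_nonneg t)
    nlinarith
  · by_contra! hcon
    refine hup fun s hs ↦ ?_
    simp only [id, mem_Icc] at hs
    rw [psiExpError_of_pos (by linarith)] at hcon
    rw [psiExpError_of_pos (by linarith)]
    have h1 := psi_exp_mul_exp_neg_le_mul (show t ≤ s by linarith)
    have h2 := mul_le_mul_of_nonneg_left (hexp (show s - t ≤ 2 * h by linarith))
      (psi_exp_mul_exp_neg_nonneg s)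
    nlinarith

/-- The prime number theorem for the Chebyshev function `ψ`. -/
theorem tendsto_psi_div_self : Tendsto (fun x ↦ Chebyshev.psi x / x) atTop (𝓝 1) := by
  have h := (tendsto_psiExpError.comp Real.tendsto_log_atTop).add_const 1
  rw [zero_add] at h
  refine h.congr' ?_
  filter_upwards [eventually_gt_atTop 1] with x hx
  have hx0 : 0 < x := one_pos.trans hx
  rw [Function.comp_apply, psiExpError_of_pos (Real.log_pos hx), Real.exp_neg, Real.exp_log hx0]
  ring

theorem tendsto_theta_div_self : Tendsto (fun x ↦ Chebyshev.theta x / x) atTop (𝓝 1) := by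
  have hsqrt : Tendsto (fun x ↦ Real.sqrt x * x⁻¹) atTop (𝓝 0) := by
    refine (tendsto_inv_atTop_zero.comp Real.tendsto_sqrt_atTop).congr fun x ↦ ?_
    rw [← div_eq_mul_inv, Real.sqrt_div_self', one_div, Function.comp_apply]
  have h := (Chebyshev.isBigO_psi_sub_theta_sqrt.mul
    (Asymptotics.isBigO_refl (fun x : ℝ ↦ x⁻¹) atTop)).trans_tendsto hsqrt
  simpa [sub_mul, div_eq_mul_inv] using tendsto_psi_div_self.sub h

/-- The **prime number theorem**. -/
theorem tendsto_primeCounting_mul_log_div_self :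
    Tendsto (fun x : ℝ ↦ (Nat.primeCounting ⌊x⌋₊ : ℝ) * Real.log x / x) atTop (𝓝 1) := by
  have hlog : Tendsto (fun x ↦ (Real.log x)⁻¹) atTop (𝓝 0) :=
    Real.tendsto_log_atTop.inv_tendsto_atTop
  have hO := (Chebyshev.primeCounting_sub_theta_div_log_isBigO.mul
    (Asymptotics.isBigO_refl (fun x ↦ Real.log x / x) atTop)).trans_tendsto
    (hlog.congr' ?_)
  · have h := hO.add tendsto_theta_div_self
    rw [zero_add] at h
    refine h.congr' ?_
    filter_upwards [eventually_gt_atTop 1] with x hx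
    have := Real.log_pos hx
    field_simp
    ring
  · filter_upwards [eventually_gt_atTop 1] with x hx
    have := Real.log_pos hx
    field_simp

theorem tendsto_div_mul_log_of_tendsto_mul_log_div {α : Type*} {f : Filter α} {x c : α → ℝ}
    (hx : Tendsto x f atTop) (hc : Tendsto (fun a ↦ c a * Real.log (x a) / x a) f (𝓝 1)) :
    Tendsto (fun a ↦ x a / (c a * Real.log (c a))) f (𝓝 1) := by
  have hlogx : Tendsto (fun a ↦ Real.log (x a)) f atTop := Real.tendsto_log_atTop.comp hx
  have hloglog : Tendsto (fun a ↦ Real.log (Real.log (x a)) / Real.log (x a)) f (𝓝 0) :=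
    Real.isLittleO_log_id_atTop.tendsto_div_nhds_zero.comp hlogx
  have hlogc : Tendsto (fun a ↦ Real.log (c a * Real.log (x a) / x a) / Real.log (x a)) f (𝓝 0) :=
    (hc.log one_ne_zero).div_atTop hlogx
  have hratio : Tendsto (fun a ↦ Real.log (c a) / Real.log (x a)) f (𝓝 1) := by
    have h := (hlogc.sub hloglog).add_const 1
    rw [sub_zero, zero_add] at h
    refine h.congr' ?_
    filter_upwards [hx.eventually_gt_atTop 1, hc.eventually (lt_mem_nhds one_pos)] with a ha hca
    have hxa : 0 < x a := one_pos.trans ha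
    have hl := Real.log_pos ha
    have hcl : c a * Real.log (x a) ≠ 0 := by
      intro h0
      simp [h0] at hca
    rw [Real.log_div hcl hxa.ne', Real.log_mul (left_ne_zero_of_mul hcl) hl.ne']
    field_simp
    ring
  have h := (hc.inv₀ one_ne_zero).mul (hratio.inv₀ one_ne_zero)
  rw [inv_one, one_mul] at h
  refine h.congr' ?_
  filter_upwards [hx.eventually_gt_atTop 1] with a ha
  have hl := Real.log_pos ha
  rw [inv_div, inv_div, div_mul_div_comm, mul_right_comm, mul_div_mul_right _ _ hl.ne']

/-- The number of primes in `(x / 2, x]`. -/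
def primesInUpperHalf (x : ℕ) : ℕ := x.primeCounting - (x / 2).primeCounting

theorem tendsto_primesInUpperHalf_mul_log_div :
    Tendsto (fun n : ℕ ↦ (2 * primesInUpperHalf n : ℝ) * Real.log n / n) atTop (𝓝 1) := by
  have hfull := tendsto_primeCounting_mul_log_div_self.comp tendsto_natCast_atTop_atTop
  have hhalf := tendsto_primeCounting_mul_log_div_self.comp
    ((tendsto_natCast_atTop_atTop (R := ℝ)).atTop_div_const two_pos)
  have hlog : Tendsto (fun n : ℕ ↦ Real.log n) atTop atTop :=
    Real.tendsto_log_atTop.comp tendsto_natCast_atTop_atTop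
  have hratio : Tendsto (fun n : ℕ ↦ Real.log n / Real.log (n / 2 : ℝ)) atTop (𝓝 1) := by
    have h := ((tendsto_const_nhds (x := Real.log 2)).div_atTop hlog).const_sub 1
    rw [sub_zero] at h
    have h' := h.inv₀ one_ne_zero
    rw [inv_one] at h'
    refine h'.congr' ?_
    filter_upwards [eventually_gt_atTop 1] with n hn
    have hl := Real.log_pos (Nat.one_lt_cast.mpr hn)
    rw [Real.log_div (by positivity) two_ne_zero, one_sub_div hl.ne', inv_div]
  have h := (hfull.const_mul 2).sub (hhalf.mul hratio)
  rw [show (2 * 1 - 1 * 1 : ℝ) = 1 by norm_num] at h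
  refine h.congr' ?_
  filter_upwards [eventually_gt_atTop 2] with n hn
  have hl : 0 < Real.log (n / 2 : ℝ) := by
    refine Real.log_pos ?_
    rw [lt_div_iff₀ two_pos, one_mul]
    exact_mod_cast hn
  simp only [Function.comp_apply, primesInUpperHalf]
  rw [Nat.cast_sub (Nat.monotone_primeCounting (Nat.div_le_self n 2)), Nat.floor_natCast,
    Nat.floor_div_ofNat, Nat.floor_natCast]
  field_simp

theorem tendsto_primesInUpperHalf : Tendsto primesInUpperHalf atTop atTop := by
  have hlin : Tendsto (fun n : ℕ ↦ (n : ℝ) / Real.log n) atTop atTop := by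
    have h : Tendsto (fun x : ℝ ↦ Real.log x / x) atTop (𝓝[>] 0) :=
      tendsto_nhdsWithin_iff.mpr ⟨Real.isLittleO_log_id_atTop.tendsto_div_nhds_zero, by
        filter_upwards [eventually_gt_atTop 1] with x hx
        exact div_pos (Real.log_pos hx) (one_pos.trans hx)⟩
    refine (h.inv_tendsto_nhdsGT_zero.comp tendsto_natCast_atTop_atTop).congr fun n ↦ ?_
    simp
  have h := tendsto_primesInUpperHalf_mul_log_div.pos_mul_atTop one_pos hlin
  have h2 : Tendsto (fun n : ℕ ↦ (2 * primesInUpperHalf n : ℝ)) atTop atTop := by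
    refine h.congr' ?_
    filter_upwards [eventually_gt_atTop 1] with n hn
    have hl := Real.log_pos (Nat.one_lt_cast.mpr hn)
    field_simp
  exact tendsto_natCast_atTop_iff.mp ((tendsto_const_mul_atTop_of_pos two_pos).mp h2)

theorem ramanujan_mem (n : ℕ) :
    0 < ramanujan n ∧ ∀ x, ramanujan n ≤ x → n ≤ primesInUpperHalf x := by
  obtain ⟨N, hN⟩ := eventually_atTop.mp (tendsto_primesInUpperHalf.eventually_ge_atTop n)
  exact Nat.sInf_mem (s := {R : ℕ | 0 < R ∧ ∀ x : ℕ, R ≤ x →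
    n ≤ x.primeCounting - (x / 2).primeCounting})
    ⟨N + 1, N.succ_pos, fun x hx ↦ hN x ((Nat.le_succ N).trans hx)⟩

theorem primesInUpperHalf_succ_le (x : ℕ) :
    primesInUpperHalf (x + 1) ≤ primesInUpperHalf x + 1 := by
  have h1 : (x + 1).primeCounting ≤ x.primeCounting + 1 := by
    rw [Nat.primeCounting, Nat.primeCounting', Nat.count_succ]
    split_ifs
    · rfl
    · exact Nat.le_succ _
  have h2 : (x / 2).primeCounting ≤ ((x + 1) / 2).primeCounting :=
    Nat.monotone_primeCounting (Nat.div_le_div_right x.le_succ)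
  simp only [primesInUpperHalf]
  lia

theorem primesInUpperHalf_ramanujan (n : ℕ) : primesInUpperHalf (ramanujan n) = n := by
  obtain ⟨hpos, hge⟩ := ramanujan_mem n
  refine le_antisymm ?_ (hge _ le_rfl)
  obtain ⟨m, hm⟩ := Nat.exists_eq_add_one_of_ne_zero hpos.ne'
  rcases m.eq_zero_or_pos with rfl | hm0
  · simp [hm, primesInUpperHalf]
  have hnot : m ∉ {R : ℕ | 0 < R ∧ ∀ x : ℕ, R ≤ x →
      n ≤ x.primeCounting - (x / 2).primeCounting} :=
    Nat.notMem_of_lt_sInf (show m < ramanujan n by lia)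
  have hlt : primesInUpperHalf m < n := by
    by_contra! hcon
    refine hnot ⟨hm0, fun x hx ↦ ?_⟩
    rcases hx.eq_or_lt with rfl | hx
    · exact hcon
    · exact hge x (by lia)
  rw [hm]
  exact (primesInUpperHalf_succ_le m).trans hlt

theorem le_ramanujan_add_one (n : ℕ) : n ≤ ramanujan n + 1 :=
  calc
    n = primesInUpperHalf (ramanujan n) := (primesInUpperHalf_ramanujan n).symm
    _ ≤ (ramanujan n).primeCounting := Nat.sub_le _ _
    _ ≤ ramanujan n + 1 := Nat.count_le _

theorem tendsto_ramanujan : Tendsto ramanujan atTop atTop :=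
  tendsto_atTop_mono (fun n ↦ Nat.sub_le_of_le_add (le_ramanujan_add_one n))
    (tendsto_sub_atTop_nat 1)

theorem primeCounting_nthPrime {k : ℕ} (hk : 0 < k) : (nthPrime k).primeCounting = k := by
  rw [nthPrime, Nat.primeCounting, Nat.primeCounting',
    Nat.count_nth_succ_of_infinite Nat.infinite_setOfPred_prime, Nat.sub_add_cancel hk]

theorem tendsto_nthPrime : Tendsto nthPrime atTop atTop :=
  tendsto_atTop_mono (fun k ↦ (Nat.le_add_right _ 2).trans (Nat.add_two_le_nth_prime (k - 1)))
    (tendsto_sub_atTop_nat 1)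

theorem tendsto_ramanujan_div :
    Tendsto (fun n : ℕ ↦ (ramanujan n : ℝ) / ((2 * n) * Real.log (2 * n))) atTop (𝓝 1) := by
  refine tendsto_div_mul_log_of_tendsto_mul_log_div
    (tendsto_natCast_atTop_atTop.comp tendsto_ramanujan) ?_
  simpa only [Function.comp_def, primesInUpperHalf_ramanujan] using
    tendsto_primesInUpperHalf_mul_log_div.comp tendsto_ramanujan

theorem tendsto_nthPrime_div :
    Tendsto (fun k : ℕ ↦ (nthPrime k : ℝ) / (k * Real.log k)) atTop (𝓝 1) := by
  have hlim := (tendsto_natCast_atTop_atTop (R := ℝ)).comp tendsto_nthPrime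
  refine tendsto_div_mul_log_of_tendsto_mul_log_div hlim ?_
  refine (tendsto_primeCounting_mul_log_div_self.comp hlim).congr' ?_
  filter_upwards [eventually_gt_atTop 0] with k hk
  simp [primeCounting_nthPrime hk]

theorem ramanujan_asymptotic_nthPrime :
    Filter.Tendsto (fun n : ℕ => (ramanujan n : ℝ) / nthPrime (2 * n))
      Filter.atTop (nhds 1) := by
  have hprime := tendsto_nthPrime_div.comp (tendsto_id.const_mul_atTop' two_pos)
  have h := tendsto_ramanujan_div.div hprime one_ne_zero
  rw [div_one] at h
  refine h.congr' ?_
  filter_upwards [eventually_gt_atTop 0] with n hn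
  have hlog : 0 < Real.log (2 * n) := Real.log_pos (by
    have : (1 : ℝ) ≤ n := by exact_mod_cast hn
    linarith)
  have hn0 : (0 : ℝ) < n := by exact_mod_cast hn
  simp only [Pi.div_apply, Function.comp_apply, id, Nat.cast_mul, Nat.cast_ofNat]
  exact div_div_div_cancel_right₀ (by positivity) _ _
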